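/- arXiv:2312.08941 — 2 statements merged into one kernel-verified Lean document; each statement's English description precedes it below -/
import Mathlib

section
/- Let p ∈ (1,∞) and ψ ∈ 𝒢^inc satisfying: there is C > 0 with C⁻¹ ≤ ψ(x,r)/ψ(y,r) ≤ C whenever |x−y| ≤ r. Then there is a constant C, depending only on n, p and ψ, such that for all f ∈ 𝓛^{(1,ψ)}(ℝⁿ), all x ∈ ℝⁿ and all r, s ∈ (0,∞) with 2r < s: ((1/|B(x,s)|)∫_{B(x,s)} |f(y) − f_{B(x,r)}|^p dy)^{1/p} ≤ C (log₂(s/r)) ψ(x,s) ‖f‖_{𝓛^{(1,ψ)}}. -/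
open MeasureTheory Metric ENNReal

/-- Average of `f` over the ball `B(x,r)`. -/
noncomputable def ballAvg (n : ℕ) (f : EuclideanSpace ℝ (Fin n) → ℝ)
    (x : EuclideanSpace ℝ (Fin n)) (r : ℝ) : ℝ :=
  ⨍ y in ball x r, f y

/-- The generalized Campanato norm `‖f‖_{𝓛^{(1,ψ)}}`. -/
noncomputable def campanatoNorm (n : ℕ)
    (ψ : EuclideanSpace ℝ (Fin n) → ℝ → ℝ) (f : EuclideanSpace ℝ (Fin n) → ℝ) : ℝ≥0∞ :=
  ⨆ (x : EuclideanSpace ℝ (Fin n)) (r : ℝ) (_ : 0 < r),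
    (∫⁻ y in ball x r, ENNReal.ofReal |f y - ballAvg n f x r|) /
      (ENNReal.ofReal (ψ x r) * volume (ball x r))

/-- `ψ ∈ 𝒢^inc`. -/
def Ginc (n : ℕ) (ψ : EuclideanSpace ℝ (Fin n) → ℝ → ℝ) : Prop :=
  ∃ C > (0 : ℝ), ∀ x (r s : ℝ), 0 < r → r < s →
    ψ x r ≤ C * ψ x s ∧ ψ x s / s ≤ C * (ψ x r / r)



section Aux
open Filter Topology Set

variable {n : ℕ}

lemma vol_scale (z w : EuclideanSpace ℝ (Fin n)) {a : ℝ} (ha : 0 < a) (r : ℝ) :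
    volume (ball z (a * r)) = ENNReal.ofReal (a ^ n) * volume (ball w r) := by
  rw [Measure.addHaar_ball_mul_of_pos volume z ha r, Measure.addHaar_ball_center volume w r]
  simp

lemma avg_sub_le {f : EuclideanSpace ℝ (Fin n) → ℝ} (hf : LocallyIntegrable f volume)
    (z : EuclideanSpace ℝ (Fin n)) {r : ℝ} (hr : 0 < r) (c : ℝ) :
    ENNReal.ofReal |ballAvg n f z r - c| * volume (ball z r)
      ≤ ∫⁻ y in ball z r, ENNReal.ofReal |f y - c| := by
  have hintegr : IntegrableOn f (ball z r) volume :=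
    (hf.integrableOn_isCompact (isCompact_closedBall z r)).mono_set ball_subset_closedBall
  have hpos : 0 < volume (ball z r) := measure_ball_pos _ _ hr
  have hfin : volume (ball z r) ≠ ⊤ := measure_ball_lt_top.ne
  have hreal : 0 < volume.real (ball z r) := ENNReal.toReal_pos hpos.ne' hfin
  have h1 : (ballAvg n f z r - c) * volume.real (ball z r) = ∫ y in ball z r, (f y - c) := by
    rw [integral_sub hintegr (integrableOn_const hfin), ballAvg, setAverage_eq, setIntegral_const]
    simp only [smul_eq_mul]
    field_simp
  have h2 := enorm_integral_le_lintegral_enorm (μ := volume.restrict (ball z r)) (fun y => f y - c)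
  rw [← h1] at h2
  simp only [Real.enorm_eq_ofReal_abs] at h2
  rw [abs_mul, ENNReal.ofReal_mul (abs_nonneg _), abs_of_pos hreal, ofReal_measureReal hfin] at h2
  exact h2

/-- comparison of averages over nested balls -/
lemma avg_comp {f : EuclideanSpace ℝ (Fin n) → ℝ} (hf : LocallyIntegrable f volume)
    {M : ℝ} (hM : 0 < M) {z w : EuclideanSpace ℝ (Fin n)} {r R a : ℝ} (hr : 0 < r) (ha : 0 < a)
    (hsub : ball z r ⊆ ball w R) (hR : R ≤ a * r)
    (hosc : ∫⁻ y in ball w R, ENNReal.ofReal |f y - ballAvg n f w R|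
      ≤ ENNReal.ofReal M * volume (ball w R)) :
    |ballAvg n f z r - ballAvg n f w R| ≤ a ^ n * M := by
  have hpos : 0 < volume (ball z r) := measure_ball_pos _ _ hr
  have hfin : volume (ball z r) ≠ ⊤ := measure_ball_lt_top.ne
  have h := (avg_sub_le hf z hr (ballAvg n f w R)).trans
    ((lintegral_mono_set hsub).trans hosc)
  have h2 : volume (ball w R) ≤ ENNReal.ofReal (a ^ n) * volume (ball z r) := by
    rw [← vol_scale w z ha r]
    exact measure_mono (ball_subset_ball hR)
  have h3 : ENNReal.ofReal |ballAvg n f z r - ballAvg n f w R| * volume (ball z r)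
      ≤ ENNReal.ofReal (a ^ n * M) * volume (ball z r) := by
    refine h.trans ?_
    rw [mul_comm (a ^ n) M, ENNReal.ofReal_mul hM.le, mul_assoc]
    gcongr
  rw [ENNReal.mul_le_mul_iff_left hpos.ne' hfin] at h3
  exact (ENNReal.ofReal_le_ofReal_iff (by positivity)).1 h3

lemma ae_leb {f : EuclideanSpace ℝ (Fin n) → ℝ} (hf : LocallyIntegrable f volume) :
    ∀ᵐ z ∂(volume : Measure (EuclideanSpace ℝ (Fin n))), ∀ ρ : ℝ, 0 < ρ →
      Tendsto (fun k : ℕ => ballAvg n f z ((1 / 8) ^ k * ρ)) atTop (𝓝 (f z)) := by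
  filter_upwards [IsUnifLocDoublingMeasure.ae_tendsto_average volume hf 1] with z hz ρ hρ
  have hp : ∀ k : ℕ, 0 < (1 / 8 : ℝ) ^ k * ρ := fun k => by positivity
  have h := hz (l := (atTop : Filter ℕ)) (fun _ => z) (fun k : ℕ => (1 / 8 : ℝ) ^ k * ρ) ?_ ?_
  · refine h.congr fun k => ?_
    refine setAverage_congr ?_
    refine (ae_eq_of_subset_of_measure_ge ball_subset_closedBall ?_
      measurableSet_ball.nullMeasurableSet measure_closedBall_lt_top.ne).symm
    rw [← ball_union_sphere]
    refine (measure_union_le _ _).trans ?_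
    rw [Measure.addHaar_sphere_of_ne_zero volume z (hp k).ne', add_zero]
  · refine tendsto_nhdsWithin_iff.2 ⟨?_, Eventually.of_forall hp⟩
    have := (tendsto_pow_atTop_nhds_zero_of_lt_one (r := (1 / 8 : ℝ)) (by norm_num)
      (by norm_num)).mul_const ρ
    simpa using this
  · exact Eventually.of_forall fun k => mem_closedBall_self (by linarith [hp k])

/-- stopping time -/
lemma stopping_radius {f : EuclideanSpace ℝ (Fin n) → ℝ} {z : EuclideanSpace ℝ (Fin n)} {ρ c L : ℝ}
    (hρ : 0 < ρ)
    (ht : Tendsto (fun k : ℕ => ballAvg n f z ((1 / 8) ^ k * ρ)) atTop (𝓝 (f z)))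
    (h0 : |ballAvg n f z ρ - c| ≤ L) (hL : L < |f z - c|) :
    ∃ r : ℝ, 0 < r ∧ 8 * r ≤ ρ ∧ |ballAvg n f z (8 * r) - c| ≤ L ∧
      L < |ballAvg n f z r - c| := by
  classical
  have hev : ∃ k : ℕ, L < |ballAvg n f z ((1 / 8) ^ k * ρ) - c| :=
    (((ht.sub_const c).abs).eventually (lt_mem_nhds hL)).exists
  have hs := Nat.find_spec hev
  have hm := fun m => Nat.find_min hev (m := m)
  rcases hk : Nat.find hev with _ | k
  · rw [hk] at hs
    simp at hs
    linarith
  · rw [hk] at hs hm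
    have h8 : 8 * ((1 / 8 : ℝ) ^ (k + 1) * ρ) = (1 / 8) ^ k * ρ := by rw [pow_succ]; ring
    refine ⟨(1 / 8) ^ (k + 1) * ρ, by positivity, ?_, ?_, hs⟩
    · rw [h8]
      have : (1 / 8 : ℝ) ^ k ≤ 1 := pow_le_one₀ (by norm_num) (by norm_num)
      nlinarith
    · rw [h8]
      exact not_lt.1 (hm k (Nat.lt_succ_self k))

lemma osc_double {f : EuclideanSpace ℝ (Fin n) → ℝ} (hf : LocallyIntegrable f volume)
    {M : ℝ} (hM : 0 < M) {y : EuclideanSpace ℝ (Fin n)} {ρ : ℝ} (hρ : 0 < ρ)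
    (hosc : ∫⁻ z in ball y (2 * ρ), ENNReal.ofReal |f z - ballAvg n f y (2 * ρ)|
      ≤ ENNReal.ofReal M * volume (ball y (2 * ρ))) :
    ∫⁻ z in ball y (2 * ρ), ENNReal.ofReal |f z - ballAvg n f y ρ|
      ≤ ENNReal.ofReal (2 ^ n * (1 + 2 ^ n) * M) * volume (ball y ρ) := by
  have hc := avg_comp hf hM hρ two_pos (ball_subset_ball (by linarith)) le_rfl hosc
  calc ∫⁻ z in ball y (2 * ρ), ENNReal.ofReal |f z - ballAvg n f y ρ|
      ≤ ∫⁻ z in ball y (2 * ρ), (ENNReal.ofReal |f z - ballAvg n f y (2 * ρ)|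
          + ENNReal.ofReal (2 ^ n * M)) := by
        refine lintegral_mono fun z => ?_
        rw [← ENNReal.ofReal_add (abs_nonneg _) (by positivity)]
        refine ENNReal.ofReal_le_ofReal ?_
        have := abs_sub_le (f z) (ballAvg n f y (2 * ρ)) (ballAvg n f y ρ)
        rw [abs_sub_comm (ballAvg n f y (2 * ρ))] at this
        linarith
    _ = (∫⁻ z in ball y (2 * ρ), ENNReal.ofReal |f z - ballAvg n f y (2 * ρ)|)
          + ENNReal.ofReal (2 ^ n * M) * volume (ball y (2 * ρ)) := by
        rw [lintegral_add_right _ measurable_const, setLIntegral_const]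
    _ ≤ ENNReal.ofReal M * volume (ball y (2 * ρ))
          + ENNReal.ofReal (2 ^ n * M) * volume (ball y (2 * ρ)) := by gcongr
    _ = ENNReal.ofReal (2 ^ n * (1 + 2 ^ n) * M) * volume (ball y ρ) := by
        rw [vol_scale y y two_pos, ← add_mul, ← ENNReal.ofReal_add hM.le (by positivity),
          ← mul_assoc, ← ENNReal.ofReal_mul (by positivity)]
        congr 2
        ring

/-- one step of the John-Nirenberg iteration -/
lemma jn_step {f : EuclideanSpace ℝ (Fin n) → ℝ} (hf : LocallyIntegrable f volume)
    {M : ℝ} (hM : 0 < M) {x : EuclideanSpace ℝ (Fin n)} {s : ℝ}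
    (hosc : ∀ z r, 0 < r → r ≤ 2 * s → dist z x ≤ 2 * s →
      ∫⁻ y in ball z r, ENNReal.ofReal |f y - ballAvg n f z r|
        ≤ ENNReal.ofReal M * volume (ball z r))
    {T : ℝ} {q : ℝ≥0∞} 
    (IH : ∀ z r, 0 < r → dist z x + 2 * r ≤ 2 * s →
      volume (ball z r ∩ {w | T < |f w - ballAvg n f z r|}) ≤ q * volume (ball z r))
    {y : EuclideanSpace ℝ (Fin n)} {ρ : ℝ} (hρ : 0 < ρ) (hyρ : dist y x + 2 * ρ ≤ 2 * s)
    (hT : 0 ≤ T) :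
    volume (ball y ρ ∩ {w | T + 2 * 16 ^ n * (1 + 2 ^ n) * M < |f w - ballAvg n f y ρ|})
      ≤ (1 / 2 * q) * volume (ball y ρ) := by
  set L : ℝ := 2 * 16 ^ n * (1 + 2 ^ n) * M with hL
  have hLpos : 0 < L := by positivity
  have hdy : 0 ≤ dist y x := dist_nonneg
  have hosc2 := hosc y (2 * ρ) (by linarith) (by linarith) (by linarith)
  set c := ballAvg n f y ρ with hc
  set G : Set (EuclideanSpace ℝ (Fin n)) := {z | ∀ ρ : ℝ, 0 < ρ →
      Tendsto (fun k : ℕ => ballAvg n f z ((1 / 8) ^ k * ρ)) atTop (𝓝 (f z))} with hG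
  have hGae : volume Gᶜ = 0 := ae_leb hf
  set E := (ball y ρ ∩ {w | T + L < |f w - c|}) ∩ G with hE
  have exists_radius : ∀ z ∈ E, ∃ r : ℝ, 0 < r ∧ 8 * r ≤ ρ / 2 ∧ |ballAvg n f z (8 * r) - c| ≤ L ∧
      L < |ballAvg n f z r - c| := by
    rintro z ⟨⟨hzy, hzT⟩, hzG⟩
    refine stopping_radius (by linarith) (hzG (ρ / 2) (by linarith)) ?_ ?_
    · have h1 := avg_comp hf hM (z := z) (r := ρ / 2) (a := 4) (by linarith) (by norm_num)
        (ball_subset_ball' (by rw [mem_ball] at hzy; linarith)) (by linarith) hosc2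
      have h2 := avg_comp hf hM (z := y) (r := ρ) (a := 2) (by linarith) (by norm_num)
        (ball_subset_ball (by linarith)) (by linarith) hosc2
      have h3 := abs_sub_le (ballAvg n f z (ρ / 2)) (ballAvg n f y (2 * ρ)) c
      rw [abs_sub_comm (ballAvg n f y (2 * ρ)) c] at h3
      have h4 : (4 : ℝ) ^ n ≤ 16 ^ n := pow_le_pow_left₀ (by norm_num) (by norm_num) n
      have h5 : (2 : ℝ) ^ n ≤ 16 ^ n := pow_le_pow_left₀ (by norm_num) (by norm_num) n
      have h6 : (0 : ℝ) ≤ 16 ^ n * 2 ^ n := by positivity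
      have h7 : (4 : ℝ) ^ n * M + 2 ^ n * M ≤ L := by
        rw [hL, ← add_mul]
        refine mul_le_mul_of_nonneg_right ?_ hM.le
        nlinarith
      linarith
    · have : T + L < |f z - c| := hzT
      linarith
  choose! r hr0 hr8 hravg hrbig using exists_radius
  obtain ⟨u, huE, hdisj, hcov⟩ := Vitali.exists_disjoint_subfamily_covering_enlargement_closedBall
    E (fun z => z) r (ρ / 2) (fun a ha => by linarith [hr0 a ha, hr8 a ha]) 5 (by norm_num)
  have hucount : u.Countable := by
    refine hdisj.countable_of_nonempty_interior fun i hi => ?_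
    exact ⟨i, ball_subset_interior_closedBall (mem_ball_self (hr0 i (huE hi)))⟩
  have hdisj' : u.PairwiseDisjoint fun a => ball a (r a) :=
    hdisj.mono fun a => ball_subset_closedBall
  have hcovE : E ⊆ ⋃ b ∈ u, (ball b (8 * r b) ∩ {w | T < |f w - ballAvg n f b (8 * r b)|}) := by
    intro z hz
    obtain ⟨b, hb, hsub⟩ := hcov z hz
    refine mem_iUnion₂.2 ⟨b, hb, ?_, ?_⟩
    · have := hsub (mem_closedBall_self (hr0 z hz).le)
      rw [mem_closedBall] at this
      rw [mem_ball]
      linarith [hr0 b (huE hb)]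
    · have h1 : T + L < |f z - c| := hz.1.2
      have h2 := hravg b (huE hb)
      have h3 := abs_sub_le (f z) (ballAvg n f b (8 * r b)) c
      change T < _
      linarith
  -- sum of the stopped balls
  set S : ℝ≥0∞ := ∑' b : u, volume (ball (b : EuclideanSpace ℝ (Fin n)) (r b)) with hS
  have hsum : ENNReal.ofReal L * S
      ≤ ENNReal.ofReal (2 ^ n * (1 + 2 ^ n) * M) * volume (ball y ρ) := by
    rw [hS, ← ENNReal.tsum_mul_left]
    calc ∑' b : u, ENNReal.ofReal L * volume (ball (b : EuclideanSpace ℝ (Fin n)) (r b))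
        ≤ ∑' b : u, ∫⁻ w in ball (b : EuclideanSpace ℝ (Fin n)) (r b), ENNReal.ofReal |f w - c| := by
          refine ENNReal.tsum_le_tsum fun b => ?_
          refine le_trans ?_ (avg_sub_le hf _ (hr0 b (huE b.2)) c)
          gcongr
          exact (hrbig b (huE b.2)).le
      _ = ∫⁻ w in ⋃ b ∈ u, ball b (r b), ENNReal.ofReal |f w - c| :=
          (lintegral_biUnion hucount (fun _ _ => measurableSet_ball) hdisj' _).symm
      _ ≤ ∫⁻ w in ball y (2 * ρ), ENNReal.ofReal |f w - c| := by
          refine lintegral_mono_set (iUnion₂_subset fun b hb => ?_)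
          refine ball_subset_ball' ?_
          have := (huE hb).1.1
          rw [mem_ball] at this
          linarith [hr8 b (huE hb), hr0 b (huE hb)]
      _ ≤ _ := osc_double hf hM hρ hosc2
  have hEle : volume E ≤ q * ENNReal.ofReal (8 ^ n) * S := by
    calc volume E ≤ ∑' b : u, volume (ball (b : EuclideanSpace ℝ (Fin n)) (8 * r b) ∩
            {w | T < |f w - ballAvg n f b (8 * r b)|}) :=
          (measure_mono hcovE).trans (measure_biUnion_le _ hucount _)
      _ ≤ ∑' b : u, q * ENNReal.ofReal (8 ^ n) *
            volume (ball (b : EuclideanSpace ℝ (Fin n)) (r b)) := by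
          refine ENNReal.tsum_le_tsum fun b => ?_
          have hb := huE b.2
          have h0 := hr0 _ hb
          have h8 := hr8 _ hb
          have hby : dist (b : EuclideanSpace ℝ (Fin n)) y < ρ := hb.1.1
          refine (IH b (8 * r b) (by linarith) ?_).trans ?_
          · have := dist_triangle (b : EuclideanSpace ℝ (Fin n)) y x
            linarith
          · rw [vol_scale _ (b : EuclideanSpace ℝ (Fin n)) (by norm_num : (0 : ℝ) < 8), mul_assoc]
      _ = _ := ENNReal.tsum_mul_left
  have hfinal : ENNReal.ofReal (8 ^ n) * S ≤ 1 / 2 * volume (ball y ρ) := by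
    have hpos : 0 < 2 ^ n * (1 + 2 ^ n) * M := by positivity
    have hLe : L = (2 * 8 ^ n) * (2 ^ n * (1 + 2 ^ n) * M) := by
      have : (16 : ℝ) ^ n = 8 ^ n * 2 ^ n := by rw [← mul_pow]; norm_num
      rw [hL, this]; ring
    rw [hLe, ENNReal.ofReal_mul (by positivity), mul_comm (ENNReal.ofReal (2 * 8 ^ n)), mul_assoc,
      ENNReal.mul_le_mul_iff_right (by simpa using hpos) ENNReal.ofReal_ne_top,
      ENNReal.ofReal_mul (by norm_num), mul_assoc] at hsum
    have h2 : (1 / 2 : ℝ≥0∞) * (2 * (ENNReal.ofReal (8 ^ n) * S)) = ENNReal.ofReal (8 ^ n) * S := by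
      rw [← mul_assoc, one_div, ENNReal.inv_mul_cancel (by norm_num) (by norm_num), one_mul]
    rw [← h2]
    gcongr
    simpa using hsum
  calc volume (ball y ρ ∩ {w | T + L < |f w - c|})
      ≤ volume (E ∪ Gᶜ) := measure_mono (by
        intro z hz
        by_cases h : z ∈ G
        · exact Or.inl ⟨hz, h⟩
        · exact Or.inr h)
    _ ≤ volume E + volume Gᶜ := measure_union_le _ _
    _ = volume E := by rw [hGae, add_zero]
    _ ≤ q * (ENNReal.ofReal (8 ^ n) * S) := by rw [← mul_assoc]; exact hEle
    _ ≤ q * (1 / 2 * volume (ball y ρ)) := by gcongr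
    _ = _ := by ring

lemma jn_dist {f : EuclideanSpace ℝ (Fin n) → ℝ} (hf : LocallyIntegrable f volume)
    {M : ℝ} (hM : 0 < M) {x : EuclideanSpace ℝ (Fin n)} {s : ℝ}
    (hosc : ∀ z r, 0 < r → r ≤ 2 * s → dist z x ≤ 2 * s →
      ∫⁻ y in ball z r, ENNReal.ofReal |f y - ballAvg n f z r|
        ≤ ENNReal.ofReal M * volume (ball z r)) (j : ℕ) :
    ∀ z r, 0 < r → dist z x + 2 * r ≤ 2 * s →
      volume (ball z r ∩ {w | j * (2 * 16 ^ n * (1 + 2 ^ n) * M) < |f w - ballAvg n f z r|})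
        ≤ (1 / 2) ^ j * volume (ball z r) := by
  induction j with
  | zero =>
    intro z r _ _
    simpa using measure_mono inter_subset_left
  | succ j ih =>
    intro z r hr hz
    have h := jn_step hf hM hosc ih hr hz (by positivity)
    rw [pow_succ', Nat.cast_succ, add_mul, one_mul]
    exact h
end Aux

section Aux2
open Filter Topology Set

variable {n : ℕ}

lemma K_ne_top (p : ℝ) :
    (∑' j : ℕ, ENNReal.ofReal (((j : ℝ) + 1) ^ p) * (1 / 2 : ℝ≥0∞) ^ j) ≠ ⊤ := by
  have hs : Summable (fun j : ℕ => ((j : ℝ) + 1) ^ p * (1 / 2 : ℝ) ^ j) := by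
    have h := summable_pow_mul_geometric_of_norm_lt_one (R := ℝ) ⌈p⌉₊ (r := 1 / 2)
      (by rw [Real.norm_eq_abs, abs_of_pos] <;> norm_num)
    have h' := ((summable_nat_add_iff 1).2 h).mul_left 2
    refine Summable.of_nonneg_of_le (fun j => by positivity) (fun j => ?_) h'
    have h1 : ((j : ℝ) + 1) ^ p ≤ ((j : ℝ) + 1) ^ ⌈p⌉₊ := by
      rw [← Real.rpow_natCast]
      exact Real.rpow_le_rpow_of_exponent_le (by linarith [(Nat.cast_nonneg j : (0 : ℝ) ≤ j)])
        (Nat.le_ceil p)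
    have h2 : 2 * (((j + 1 : ℕ) : ℝ) ^ ⌈p⌉₊ * (1 / 2 : ℝ) ^ (j + 1))
        = ((j : ℝ) + 1) ^ ⌈p⌉₊ * (1 / 2 : ℝ) ^ j := by
      push_cast; rw [pow_succ (1 / 2 : ℝ)]; ring
    rw [h2]
    gcongr
  have := hs.tsum_ofReal_ne_top
  convert this using 4 with j
  rw [ENNReal.ofReal_mul (by positivity), ENNReal.ofReal_pow (by norm_num),
    ENNReal.ofReal_div_of_pos two_pos]
  simp

lemma pointwise_layer {p Λ a : ℝ} (hp : 1 < p) (hΛ : 0 < Λ) (ha : 0 ≤ a) :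
    ENNReal.ofReal (a ^ p) ≤ ∑' j : ℕ, ENNReal.ofReal (Λ ^ p * ((j : ℝ) + 1) ^ p) *
      (if j * Λ < a then 1 else 0) := by
  rcases ha.eq_or_lt with rfl | ha
  · rw [Real.zero_rpow (by linarith)]; simp
  · obtain ⟨j, hj⟩ : ∃ j, ⌈a / Λ⌉₊ = j + 1 :=
      Nat.exists_eq_succ_of_ne_zero (Nat.ceil_pos.2 (by positivity)).ne'
    have h1 : (j : ℝ) * Λ < a := by
      rw [← lt_div_iff₀ hΛ]
      exact Nat.lt_ceil.1 (by omega)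
    have h2 : a ≤ Λ * ((j : ℝ) + 1) := by
      have := Nat.le_ceil (a / Λ)
      rw [hj, div_le_iff₀ hΛ] at this
      push_cast at this
      linarith
    refine le_trans ?_ (ENNReal.le_tsum j)
    rw [if_pos h1, mul_one, ← Real.mul_rpow hΛ.le (by positivity)]
    exact ENNReal.ofReal_le_ofReal (Real.rpow_le_rpow ha.le h2 (by linarith))

lemma jn_Lp {f : EuclideanSpace ℝ (Fin n) → ℝ} (hf : LocallyIntegrable f volume)
    {M p : ℝ} (hp : 1 < p) (hM : 0 < M) {x : EuclideanSpace ℝ (Fin n)} {s : ℝ} (hs : 0 < s)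
    (hosc : ∀ z r, 0 < r → r ≤ 2 * s → dist z x ≤ 2 * s →
      ∫⁻ y in ball z r, ENNReal.ofReal |f y - ballAvg n f z r|
        ≤ ENNReal.ofReal M * volume (ball z r)) :
    ∫⁻ y in ball x s, ENNReal.ofReal (|f y - ballAvg n f x s| ^ p)
      ≤ ENNReal.ofReal ((2 * 16 ^ n * (1 + 2 ^ n) * M) ^ p) *
        (∑' j : ℕ, ENNReal.ofReal (((j : ℝ) + 1) ^ p) * (1 / 2 : ℝ≥0∞) ^ j) *
          volume (ball x s) := by
  set Λ : ℝ := 2 * 16 ^ n * (1 + 2 ^ n) * M with hΛ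
  have hΛpos : 0 < Λ := by positivity
  have hfm : AEMeasurable (fun y => |f y - ballAvg n f x s|) (volume.restrict (ball x s)) := by
    have h := hf.aestronglyMeasurable.aemeasurable
    exact ((h.sub_const _).norm).restrict
  have hnm : ∀ j : ℕ, NullMeasurableSet {w | j * Λ < |f w - ballAvg n f x s|}
      (volume.restrict (ball x s)) := fun j => nullMeasurableSet_lt aemeasurable_const hfm
  have heq : ∀ (j : ℕ) (y : EuclideanSpace ℝ (Fin n)),
      (if j * Λ < |f y - ballAvg n f x s| then (1 : ℝ≥0∞) else 0)
        = indicator {w | j * Λ < |f w - ballAvg n f x s|} (fun _ => 1) y := by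
    intro j y; simp [indicator_apply]
  calc ∫⁻ y in ball x s, ENNReal.ofReal (|f y - ballAvg n f x s| ^ p)
      ≤ ∫⁻ y in ball x s, ∑' j : ℕ, ENNReal.ofReal (Λ ^ p * ((j : ℝ) + 1) ^ p) *
          indicator {w | j * Λ < |f w - ballAvg n f x s|} (fun _ => 1) y := by
        refine lintegral_mono fun y => ?_
        simp only [← heq]
        exact pointwise_layer hp hΛpos (abs_nonneg _)
    _ = ∑' j : ℕ, ENNReal.ofReal (Λ ^ p * ((j : ℝ) + 1) ^ p) *
          volume (ball x s ∩ {w | j * Λ < |f w - ballAvg n f x s|}) := by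
        rw [lintegral_tsum]
        · refine tsum_congr fun j => ?_
          rw [lintegral_const_mul' _ _ ENNReal.ofReal_ne_top, lintegral_indicator_const₀ (hnm j),
            one_mul, Measure.restrict_apply₀ (hnm j), inter_comm]
        · intro j
          exact (aemeasurable_const.indicator₀ (hnm j)).const_mul _
    _ ≤ ∑' j : ℕ, ENNReal.ofReal (Λ ^ p * ((j : ℝ) + 1) ^ p) *
          ((1 / 2) ^ j * volume (ball x s)) := by
        refine ENNReal.tsum_le_tsum fun j => ?_
        gcongr
        exact jn_dist hf hM hosc j x s hs (by simp)
    _ = _ := by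
        rw [← ENNReal.tsum_mul_left, ← ENNReal.tsum_mul_right]
        refine tsum_congr fun j => ?_
        rw [ENNReal.ofReal_mul (by positivity)]
        ring

lemma telescope {f : EuclideanSpace ℝ (Fin n) → ℝ} (hf : LocallyIntegrable f volume)
    {M : ℝ} (hM : 0 < M) {x : EuclideanSpace ℝ (Fin n)} {s : ℝ}
    (hosc : ∀ r, 0 < r → r ≤ s →
      ∫⁻ y in ball x r, ENNReal.ofReal |f y - ballAvg n f x r|
        ≤ ENNReal.ofReal M * volume (ball x r)) (k : ℕ) :
    ∀ r, 0 < r → 2 ^ k * r ≤ s → s < 2 ^ (k + 1) * r →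
      |ballAvg n f x r - ballAvg n f x s| ≤ (k + 1) * (2 ^ n * M) := by
  induction k with
  | zero =>
    intro r hr h1 h2
    norm_num at h1 h2
    have := avg_comp hf hM hr two_pos (ball_subset_ball h1) h2.le (hosc s (by linarith) le_rfl)
    simpa using this
  | succ k ih =>
    intro r hr h1 h2
    have hk : (1 : ℝ) ≤ 2 ^ k := one_le_pow₀ (by norm_num)
    rw [pow_succ] at h1 h2
    have h3 : 2 * r ≤ s := by nlinarith
    have ih' := ih (2 * r) (by linarith) (by linarith) (by linarith)
    have := avg_comp hf hM hr two_pos (ball_subset_ball (x := x) (by linarith : r ≤ 2 * r)) le_rfl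
      (hosc (2 * r) (by linarith) h3)
    have h4 := abs_sub_le (ballAvg n f x r) (ballAvg n f x (2 * r)) (ballAvg n f x s)
    push_cast
    linarith

lemma telescope_log {f : EuclideanSpace ℝ (Fin n) → ℝ} (hf : LocallyIntegrable f volume)
    {M : ℝ} (hM : 0 < M) {x : EuclideanSpace ℝ (Fin n)} {r s : ℝ} (hr : 0 < r) (hrs : 2 * r < s)
    (hosc : ∀ r, 0 < r → r ≤ s →
      ∫⁻ y in ball x r, ENNReal.ofReal |f y - ballAvg n f x r|
        ≤ ENNReal.ofReal M * volume (ball x r)) :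
    |ballAvg n f x r - ballAvg n f x s| ≤ 2 ^ (n + 1) * (Real.logb 2 (s / r) * M) := by
  have h2 : 2 ≤ s / r := by rw [le_div_iff₀ hr]; exact hrs.le
  have hL : 1 ≤ Real.logb 2 (s / r) := by
    rw [Real.le_logb_iff_rpow_le (by norm_num) (by linarith)]; simpa using h2
  set k := ⌊Real.logb 2 (s / r)⌋₊ with hk
  have hk1 : (k : ℝ) ≤ Real.logb 2 (s / r) := Nat.floor_le (by linarith)
  have hk2 : Real.logb 2 (s / r) < k + 1 := Nat.lt_floor_add_one _
  have h := telescope hf hM hosc k r hr ?_ ?_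
  · refine h.trans ?_
    rw [pow_succ]
    have : (0 : ℝ) < 2 ^ n * M := by positivity
    nlinarith
  · rw [Real.le_logb_iff_rpow_le (by norm_num) (by linarith), Real.rpow_natCast,
      le_div_iff₀ hr] at hk1
    exact hk1
  · rw [Real.logb_lt_iff_lt_rpow (by norm_num) (by linarith)] at hk2
    rw [← div_lt_iff₀ hr]
    exact_mod_cast hk2

lemma core {p : ℝ} (hp : 1 < p) : ∃ C : ℝ≥0∞, 0 < C ∧ C ≠ ⊤ ∧
    ∀ f : EuclideanSpace ℝ (Fin n) → ℝ, LocallyIntegrable f volume →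
    ∀ (M : ℝ) (x : EuclideanSpace ℝ (Fin n)) (r s : ℝ), 0 < M → 0 < r → 2 * r < s →
    (∀ z r, 0 < r → r ≤ 2 * s → dist z x ≤ 2 * s →
      ∫⁻ y in ball z r, ENNReal.ofReal |f y - ballAvg n f z r|
        ≤ ENNReal.ofReal M * volume (ball z r)) →
    ((∫⁻ y in ball x s, ENNReal.ofReal (|f y - ballAvg n f x r| ^ p)) /
              volume (ball x s)) ^ (1 / p)
      ≤ C * ENNReal.ofReal (Real.logb 2 (s / r) * M) := by
  have hp0 : 0 < p := by linarith
  set K := ∑' j : ℕ, ENNReal.ofReal (((j : ℝ) + 1) ^ p) * (1 / 2 : ℝ≥0∞) ^ j with hK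
  have hKtop : K ≠ ⊤ := K_ne_top p
  set A : ℝ := 2 * 16 ^ n * (1 + 2 ^ n) with hA
  have hApos : 0 < A := by positivity
  set C1 : ℝ≥0∞ := 2 ^ (p - 1) *
    (ENNReal.ofReal A ^ p * K + ENNReal.ofReal (2 ^ (n + 1)) ^ p) with hC1
  have hC1top : C1 ≠ ⊤ := by
    refine ENNReal.mul_ne_top (ENNReal.rpow_ne_top_of_nonneg (by linarith) (by norm_num)) ?_
    refine ENNReal.add_ne_top.2 ⟨ENNReal.mul_ne_top ?_ hKtop, ?_⟩ <;>
    exact ENNReal.rpow_ne_top_of_nonneg hp0.le ENNReal.ofReal_ne_top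
  refine ⟨C1 ^ (1 / p) + 1, by positivity, ?_, ?_⟩
  · exact ENNReal.add_ne_top.2
      ⟨ENNReal.rpow_ne_top_of_nonneg (by positivity) hC1top, ENNReal.one_ne_top⟩
  intro f hf M x r s hM hr hrs hosc
  have hs : 0 < s := by linarith
  have hL : 1 ≤ Real.logb 2 (s / r) := by
    rw [Real.le_logb_iff_rpow_le (by norm_num) (by positivity), Real.rpow_one, le_div_iff₀ hr]
    exact hrs.le
  set L := Real.logb 2 (s / r) with hLdef
  have hb := telescope_log hf hM (x := x) hr hrs
    (fun t ht hts => hosc x t ht (by linarith) (by simp; linarith))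
  rw [← hLdef] at hb
  have hLM : 0 < L * M := by positivity
  set X := ENNReal.ofReal (L * M) with hX
  set V := volume (ball x s) with hV
  have hVpos : V ≠ 0 := (measure_ball_pos _ _ hs).ne'
  have hVtop : V ≠ ⊤ := measure_ball_lt_top.ne
  have hmain := jn_Lp hf hp hM hs hosc
  rw [← hK, ← hA, ← hV] at hmain
  have hAX : ENNReal.ofReal ((A * M) ^ p) ≤ ENNReal.ofReal A ^ p * X ^ p := by
    rw [← ENNReal.ofReal_rpow_of_pos (by positivity), ← ENNReal.mul_rpow_of_nonneg _ _ hp0.le, hX,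
      ← ENNReal.ofReal_mul hApos.le]
    gcongr
    nlinarith
  have hintegr : ∫⁻ y in ball x s, ENNReal.ofReal (|f y - ballAvg n f x r| ^ p) ≤ C1 * X ^ p * V := by
    calc ∫⁻ y in ball x s, ENNReal.ofReal (|f y - ballAvg n f x r| ^ p)
        ≤ ∫⁻ y in ball x s, 2 ^ (p - 1) * (ENNReal.ofReal (|f y - ballAvg n f x s| ^ p) +
            (ENNReal.ofReal (2 ^ (n + 1)) * X) ^ p) := by
          refine lintegral_mono fun y => ?_
          rw [← ENNReal.ofReal_rpow_of_nonneg (abs_nonneg _) hp0.le,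
            ← ENNReal.ofReal_rpow_of_nonneg (abs_nonneg _) hp0.le]
          refine le_trans ?_ (ENNReal.rpow_add_le_mul_rpow_add_rpow _ _ hp.le)
          gcongr
          rw [hX, ← ENNReal.ofReal_mul (by positivity),
            ← ENNReal.ofReal_add (abs_nonneg _) (by positivity)]
          refine ENNReal.ofReal_le_ofReal ?_
          have := abs_sub_le (f y) (ballAvg n f x s) (ballAvg n f x r)
          rw [abs_sub_comm (ballAvg n f x s)] at this
          linarith
      _ = 2 ^ (p - 1) * ((∫⁻ y in ball x s, ENNReal.ofReal (|f y - ballAvg n f x s| ^ p)) +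
            (ENNReal.ofReal (2 ^ (n + 1)) * X) ^ p * V) := by
          rw [lintegral_const_mul' _ _
              (ENNReal.rpow_ne_top_of_nonneg (by linarith) (by norm_num)),
            lintegral_add_right _ measurable_const, setLIntegral_const]
      _ ≤ 2 ^ (p - 1) * (ENNReal.ofReal A ^ p * X ^ p * K * V +
            (ENNReal.ofReal (2 ^ (n + 1)) * X) ^ p * V) := by
          gcongr
          refine hmain.trans ?_
          gcongr
      _ = C1 * X ^ p * V := by
          rw [hC1, ENNReal.mul_rpow_of_nonneg _ _ hp0.le]
          ring
  calc _ ≤ (C1 * X ^ p) ^ (1 / p) := by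
        refine ENNReal.rpow_le_rpow ?_ (by positivity)
        exact ENNReal.div_le_of_le_mul hintegr
    _ = C1 ^ (1 / p) * X := by
        rw [ENNReal.mul_rpow_of_nonneg _ _ (by positivity), ← ENNReal.rpow_mul,
          mul_one_div_cancel hp0.ne', ENNReal.rpow_one]
    _ ≤ _ := by gcongr; exact le_self_add

lemma osc_of_norm {ψ : EuclideanSpace ℝ (Fin n) → ℝ → ℝ} (hψpos : ∀ x r, 0 < r → 0 < ψ x r)
    {f : EuclideanSpace ℝ (Fin n) → ℝ} (z : EuclideanSpace ℝ (Fin n)) {r : ℝ} (hr : 0 < r) :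
    ∫⁻ y in ball z r, ENNReal.ofReal |f y - ballAvg n f z r|
      ≤ campanatoNorm n ψ f * (ENNReal.ofReal (ψ z r) * volume (ball z r)) := by
  have hψ : ENNReal.ofReal (ψ z r) ≠ 0 := by simpa using hψpos z r hr
  rw [← ENNReal.div_le_iff]
  · exact le_iSup_of_le z (le_iSup_of_le r (le_iSup_of_le hr le_rfl))
  · exact mul_ne_zero hψ (measure_ball_pos _ _ hr).ne'
  · exact ENNReal.mul_ne_top ENNReal.ofReal_ne_top measure_ball_lt_top.ne

end Aux2

/-- for `p ∈ (1,∞)`, `ψ ∈ 𝒢^inc` spatially uniform, and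
`f ∈ 𝓛^{(1,ψ)}`, if `2r < s` then
`(⨍_{B(x,s)} |f − f_{B(x,r)}|^p)^{1/p} ≤ C log₂(s/r) ψ(x,s) ‖f‖_{𝓛^{(1,ψ)}}`. -/
theorem campanato_mean_oscillation_log_bound (n : ℕ) (p : ℝ) (hp : 1 < p)
    (ψ : EuclideanSpace ℝ (Fin n) → ℝ → ℝ)
    (hψpos : ∀ x r, 0 < r → 0 < ψ x r)
    (hψinc : Ginc n ψ)
    (hψunif : ∃ C > (0 : ℝ), ∀ x y (r : ℝ), 0 < r → dist x y ≤ r → ψ x r ≤ C * ψ y r) :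
    ∃ C : ℝ≥0∞, 0 < C ∧ C ≠ ⊤ ∧
      ∀ f : EuclideanSpace ℝ (Fin n) → ℝ, LocallyIntegrable f volume →
        campanatoNorm n ψ f ≠ ⊤ →
        ∀ x (r s : ℝ), 0 < r → 2 * r < s →
          ((∫⁻ y in ball x s, ENNReal.ofReal (|f y - ballAvg n f x r| ^ p)) /
              volume (ball x s)) ^ (1 / p)
            ≤ C * ENNReal.ofReal (Real.logb 2 (s / r) * ψ x s) * campanatoNorm n ψ f := by
  obtain ⟨C1, hC1, hinc⟩ := hψinc
  obtain ⟨C2, hC2, hunif⟩ := hψunif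
  obtain ⟨C, hC0, hCtop, hcore⟩ := core (n := n) hp
  set D : ℝ := 3 * C1 * C1 * C2 with hD
  have hDpos : 0 < D := by positivity
  refine ⟨C * ENNReal.ofReal D, ?_, ENNReal.mul_ne_top hCtop ENNReal.ofReal_ne_top, ?_⟩
  · exact ENNReal.mul_pos hC0.ne' (by simpa using hDpos)
  intro f hf hN x r s hr hrs
  have hs : 0 < s := by linarith
  have hψcmp : ∀ z t, 0 < t → t ≤ 2 * s → dist z x ≤ 2 * s → ψ z t ≤ D * ψ x s := by
    intro z t ht hts hz
    have h1 := (hinc z t (3 * s) ht (by linarith)).1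
    have h2 := hunif z x (3 * s) (by linarith) (by linarith)
    have h3 := (hinc x s (3 * s) hs (by linarith)).2
    have h4 : ψ x (3 * s) ≤ 3 * C1 * ψ x s := by
      rw [div_le_iff₀ (by linarith)] at h3
      calc ψ x (3 * s) ≤ C1 * (ψ x s / s) * (3 * s) := h3
        _ = 3 * C1 * ψ x s := by field_simp
    calc ψ z t ≤ C1 * ψ z (3 * s) := h1
      _ ≤ C1 * (C2 * ψ x (3 * s)) := by gcongr
      _ ≤ C1 * (C2 * (3 * C1 * ψ x s)) := by gcongr
      _ = D * ψ x s := by rw [hD]; ring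
  have hψs := hψpos x s hs
  have hLpos : 0 ≤ Real.logb 2 (s / r) := by
    refine Real.logb_nonneg (by norm_num) ?_
    rw [le_div_iff₀ hr]; linarith
  have hkey : ∀ ε : ℝ, 0 < ε →
      ((∫⁻ y in ball x s, ENNReal.ofReal (|f y - ballAvg n f x r| ^ p)) /
        volume (ball x s)) ^ (1 / p)
      ≤ C * ENNReal.ofReal D * ENNReal.ofReal (Real.logb 2 (s / r) * ψ x s) *
        ENNReal.ofReal ((campanatoNorm n ψ f).toReal + ε) := by
    intro ε hε
    set N := (campanatoNorm n ψ f).toReal + ε with hNdef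
    have hNpos : 0 < N := add_pos_of_nonneg_of_pos ENNReal.toReal_nonneg hε
    have hNle : campanatoNorm n ψ f ≤ ENNReal.ofReal N := by
      rw [ENNReal.le_ofReal_iff_toReal_le hN hNpos.le]; linarith
    have h := hcore f hf (D * ψ x s * N) x r s (by positivity) hr hrs ?_
    · refine h.trans (le_of_eq ?_)
      rw [mul_assoc C, ← ENNReal.ofReal_mul hDpos.le, mul_assoc C, ← ENNReal.ofReal_mul (by positivity)]
      congr 2
      ring
    · intro z t ht hts hz
      refine (osc_of_norm hψpos z ht).trans ?_
      rw [← mul_assoc]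
      gcongr
      rw [ENNReal.ofReal_mul (by positivity), mul_comm]
      gcongr
      exact hψcmp z t ht hts hz
  have hB : C * ENNReal.ofReal D * ENNReal.ofReal (Real.logb 2 (s / r) * ψ x s) ≠ ⊤ :=
    ENNReal.mul_ne_top (ENNReal.mul_ne_top hCtop ENNReal.ofReal_ne_top) ENNReal.ofReal_ne_top
  have hcont : Continuous fun ε : ℝ =>
      C * ENNReal.ofReal D * ENNReal.ofReal (Real.logb 2 (s / r) * ψ x s) *
        ENNReal.ofReal ((campanatoNorm n ψ f).toReal + ε) :=
    (ENNReal.continuous_const_mul hB).comp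
      (ENNReal.continuous_ofReal.comp (continuous_const.add continuous_id))
  have hlim := (hcont.tendsto 0).mono_left (nhdsWithin_le_nhds (s := Set.Ioi (0 : ℝ)))
  simp only [add_zero, ENNReal.ofReal_toReal hN] at hlim
  exact ge_of_tendsto hlim (Filter.eventually_of_mem self_mem_nhdsWithin hkey)
end

section
/- Let 1 < p ≤ q < ∞ and ρ, φ be positive measurable functions on ℝⁿ×(0,∞). Assume φ ∈ 𝒢^dec and lim_{r→0} φ(x,r) = ∞, lim_{r→∞} φ(x,r) = 0 for each x. Assume also that there is C₀ > 0 such that ρ(x,r)φ(x,r)^{1/p} ≤ C₀ φ(x,r)^{1/q} for all x ∈ ℝⁿ and r > 0. Then the generalized fractional maximal operator M_ρ is bounded from L^{(p,φ)}(ℝⁿ) to L^{(q,φ)}(ℝⁿ): there is C > 0 with ‖M_ρ f‖_{L^{(q,φ)}} ≤ C ‖f‖_{L^{(p,φ)}} for all f ∈ L^{(p,φ)}(ℝⁿ). -/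
open MeasureTheory Metric ENNReal Filter

/-- The generalized Morrey norm of a real function. -/
noncomputable def morreyNorm (n : ℕ) (p : ℝ)
    (φ : EuclideanSpace ℝ (Fin n) → ℝ → ℝ) (f : EuclideanSpace ℝ (Fin n) → ℝ) : ℝ≥0∞ :=
  ⨆ (x : EuclideanSpace ℝ (Fin n)) (r : ℝ) (_ : 0 < r),
    ((∫⁻ y in ball x r, ENNReal.ofReal (|f y| ^ p)) /
      (ENNReal.ofReal (φ x r) * volume (ball x r))) ^ (1 / p)

/-- The generalized Morrey norm of an `ℝ≥0∞`-valued function. -/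
noncomputable def morreyNormE (n : ℕ) (p : ℝ)
    (φ : EuclideanSpace ℝ (Fin n) → ℝ → ℝ) (g : EuclideanSpace ℝ (Fin n) → ℝ≥0∞) : ℝ≥0∞ :=
  ⨆ (x : EuclideanSpace ℝ (Fin n)) (r : ℝ) (_ : 0 < r),
    ((∫⁻ y in ball x r, g y ^ p) /
      (ENNReal.ofReal (φ x r) * volume (ball x r))) ^ (1 / p)

/-- The generalized fractional maximal operator
`M_ρ f(x) = sup_{B ∋ x} ρ(B) ⨍_B |f|`. -/
noncomputable def genMaximal (n : ℕ) (ρ : EuclideanSpace ℝ (Fin n) → ℝ → ℝ)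
    (f : EuclideanSpace ℝ (Fin n) → ℝ) (x : EuclideanSpace ℝ (Fin n)) : ℝ≥0∞ :=
  ⨆ (z : EuclideanSpace ℝ (Fin n)) (r : ℝ) (_ : 0 < r) (_ : x ∈ ball z r),
    ENNReal.ofReal (ρ z r) *
      ((∫⁻ y in ball z r, ENNReal.ofReal |f y|) / volume (ball z r))

/-- `φ ∈ 𝒢^dec`: `φ` is almost decreasing and `φ(x,r)rⁿ` is almost increasing. -/
def Gdec (n : ℕ) (φ : EuclideanSpace ℝ (Fin n) → ℝ → ℝ) : Prop :=
  ∃ C > (0 : ℝ), ∀ x (r s : ℝ), 0 < r → r < s →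
    φ x s ≤ C * φ x r ∧ φ x r * r ^ (n : ℝ) ≤ C * (φ x s * s ^ (n : ℝ))


/-- Average of `g` over a ball. -/
noncomputable def avgB {n : ℕ} (g : EuclideanSpace ℝ (Fin n) → ℝ≥0∞)
    (z : EuclideanSpace ℝ (Fin n)) (r : ℝ) : ℝ≥0∞ :=
  (∫⁻ y in ball z r, g y) / volume (ball z r)

/-- Uncentered maximal function with radii at most `R`. -/
noncomputable def MR {n : ℕ} (R : ℝ) (g : EuclideanSpace ℝ (Fin n) → ℝ≥0∞)
    (y : EuclideanSpace ℝ (Fin n)) : ℝ≥0∞ :=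
  ⨆ (z : EuclideanSpace ℝ (Fin n)) (r : ℝ) (_ : 0 < r) (_ : r ≤ R) (_ : y ∈ ball z r), avgB g z r

theorem lt_MR_iff {n : ℕ} (R : ℝ) (g : EuclideanSpace ℝ (Fin n) → ℝ≥0∞)
    (y : EuclideanSpace ℝ (Fin n)) (t : ℝ≥0∞) :
    t < MR R g y ↔ ∃ z r, 0 < r ∧ r ≤ R ∧ y ∈ ball z r ∧ t < avgB g z r := by
  simp only [MR, lt_iSup_iff, exists_prop]

theorem measurable_MR {n : ℕ} (R : ℝ) (g : EuclideanSpace ℝ (Fin n) → ℝ≥0∞) :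
    Measurable (MR R g) := by
  refine measurable_of_Ioi fun t => IsOpen.measurableSet ?_
  rw [isOpen_iff_forall_mem_open]
  intro y hy
  obtain ⟨z, r, h0, hR, hyz, ht⟩ := (lt_MR_iff R g y t).1 hy
  exact ⟨ball z r, fun y' hy' => (lt_MR_iff R g y' t).2 ⟨z, r, h0, hR, hy', ht⟩, isOpen_ball, hyz⟩

theorem vol_ball_mul {n : ℕ} (x : EuclideanSpace ℝ (Fin n)) {k : ℝ} (hk : 0 < k) (r : ℝ) :
    volume (ball x (k * r)) = ENNReal.ofReal (k ^ n) * volume (ball x r) := by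
  rw [Measure.addHaar_ball_mul_of_pos volume x hk r, Measure.addHaar_ball_center volume x r]
  simp

theorem vol_ball_ne_zero {n : ℕ} (x : EuclideanSpace ℝ (Fin n)) {r : ℝ} (hr : 0 < r) :
    volume (ball x r) ≠ 0 := (measure_ball_pos volume x hr).ne'

theorem vol_ball_ne_top {n : ℕ} (x : EuclideanSpace ℝ (Fin n)) (r : ℝ) :
    volume (ball x r) ≠ ⊤ := measure_ball_lt_top.ne

theorem weak_MR {n : ℕ} (R : ℝ) (g : EuclideanSpace ℝ (Fin n) → ℝ≥0∞) (t : ℝ≥0∞) :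
    t * volume {y | t < MR R g y} ≤ ENNReal.ofReal (5 ^ n) * ∫⁻ y, g y := by
  let T : Set (EuclideanSpace ℝ (Fin n) × ℝ) := {a | 0 < a.2 ∧ a.2 ≤ R ∧ t < avgB g a.1 a.2}
  obtain ⟨u, huT, hdisj, hcov⟩ :=
    Vitali.exists_disjoint_subfamily_covering_enlargement_closedBall T (fun a => a.1)
      (fun a => a.2) R (fun a ha => ha.2.1) 4 (by norm_num)
  have hdisj' : u.PairwiseDisjoint fun a => ball a.1 a.2 :=
    hdisj.mono fun a => ball_subset_closedBall
  have hcount : u.Countable := hdisj'.countable_of_isOpen (fun _ _ => isOpen_ball)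
    (fun a ha => nonempty_ball.2 (huT ha).1)
  have hsub : {y | t < MR R g y} ⊆ ⋃ a ∈ u, ball a.1 (5 * a.2) := by
    intro y hy
    obtain ⟨z, r, h0, hR, hyz, ht⟩ := (lt_MR_iff R g y t).1 hy
    obtain ⟨b, hb, hsb⟩ := hcov (z, r) ⟨h0, hR, ht⟩
    have := hsb (ball_subset_closedBall hyz)
    simp only [Set.mem_iUnion]
    refine ⟨b, hb, ?_⟩
    have hb0 : 0 < b.2 := (huT hb).1
    rw [mem_closedBall] at this
    rw [mem_ball]; linarith
  have key : ∀ a : u, t * volume (ball a.1.1 (5 * a.1.2)) ≤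
      ENNReal.ofReal (5 ^ n) * ∫⁻ y in ball a.1.1 a.1.2, g y := by
    intro a
    rw [vol_ball_mul _ (by norm_num)]
    have h := (huT a.2).2.2.le
    unfold avgB at h
    rw [ENNReal.le_div_iff_mul_le (Or.inl (vol_ball_ne_zero _ (huT a.2).1))
      (Or.inl (vol_ball_ne_top _ _))] at h
    calc _ = ENNReal.ofReal (5 ^ n) * (t * volume (ball a.1.1 a.1.2)) := by ring
      _ ≤ _ := by gcongr
  calc t * volume {y | t < MR R g y} ≤ t * ∑' a : u, volume (ball a.1.1 (5 * a.1.2)) := by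
        gcongr
        exact (measure_mono hsub).trans (measure_biUnion_le _ hcount _)
    _ = ∑' a : u, t * volume (ball a.1.1 (5 * a.1.2)) := ENNReal.tsum_mul_left.symm
    _ ≤ ∑' a : u, ENNReal.ofReal (5 ^ n) * ∫⁻ y in ball a.1.1 a.1.2, g y :=
        ENNReal.tsum_le_tsum key
    _ = ENNReal.ofReal (5 ^ n) * ∑' a : u, ∫⁻ y in ball a.1.1 a.1.2, g y := ENNReal.tsum_mul_left
    _ = ENNReal.ofReal (5 ^ n) * ∫⁻ y in ⋃ a ∈ u, ball a.1 a.2, g y := by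
        rw [lintegral_biUnion hcount (fun _ _ => measurableSet_ball) hdisj']
    _ ≤ _ := by exact mul_le_mul_right (setLIntegral_le_lintegral _ _) _

/-- Truncated weak type estimate. -/
theorem weak_MR' {n : ℕ} (R : ℝ) (g : EuclideanSpace ℝ (Fin n) → ℝ≥0∞) (hg : Measurable g)
    (t : ℝ≥0∞) (ht : t ≠ ⊤) :
    t * volume {y | t + t < MR R g y} ≤
      ENNReal.ofReal (5 ^ n) * ∫⁻ y, {y | t < g y}.indicator g y := by
  refine le_trans ?_ (weak_MR R _ t)
  refine mul_le_mul_right (measure_mono fun y hy => ?_) _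
  obtain ⟨z, r, h0, hR, hyz, hlt⟩ := (lt_MR_iff R g y _).1 hy
  refine (lt_MR_iff R _ y t).2 ⟨z, r, h0, hR, hyz, ?_⟩
  have : avgB g z r ≤ avgB ({y | t < g y}.indicator g) z r + t := by
    unfold avgB
    have : ∫⁻ y in ball z r, g y ≤
        (∫⁻ y in ball z r, {y | t < g y}.indicator g y) + t * volume (ball z r) := by
      rw [← setLIntegral_const, ← lintegral_add_right _ measurable_const]
      refine lintegral_mono fun y => ?_
      by_cases h : t < g y
      · simp [Set.indicator, h]
      · simp [Set.indicator, h]; exact not_lt.1 h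
    refine (ENNReal.div_le_div_right this _).trans ?_
    rw [ENNReal.add_div, ENNReal.mul_div_cancel_right (vol_ball_ne_zero _ h0) (vol_ball_ne_top _ _)]
  exact lt_of_add_lt_add_right (hlt.trans_le this)

theorem layer_fin {a : ℝ} (ha : 0 < a) (x : ℝ) (hx : 0 ≤ x) :
    ∫⁻ t in Set.Ioi (0:ℝ), (if ENNReal.ofReal t < ENNReal.ofReal x then
      ENNReal.ofReal (t ^ (a - 1)) else 0) = ENNReal.ofReal (x ^ a / a) := by
  have h1 : ∫ t in (0:ℝ)..x, t ^ (a - 1) = x ^ a / a := by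
    rw [integral_rpow (Or.inl (by linarith))]
    simp [Real.zero_rpow ha.ne']
  have hint := intervalIntegral.intervalIntegrable_rpow' (a := 0) (b := x) (r := a - 1)
    (by linarith)
  rw [intervalIntegral.integral_of_le hx] at h1
  rw [intervalIntegrable_iff_integrableOn_Ioc_of_le hx] at hint
  rw [← h1, ofReal_integral_eq_lintegral_ofReal hint, ← setLIntegral_congr Ioo_ae_eq_Ioc,
    ← lintegral_indicator measurableSet_Ioi, ← lintegral_indicator measurableSet_Ioo]
  · congr 1
    ext t
    simp only [Set.indicator, Set.mem_Ioi, Set.mem_Ioo]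
    by_cases h0 : 0 < t
    · simp only [h0, if_true, true_and, ENNReal.ofReal_lt_ofReal_iff_of_nonneg h0.le]
    · simp [h0]
  · exact (ae_restrict_iff' measurableSet_Ioc).2
      (Eventually.of_forall fun t ht => Real.rpow_nonneg ht.1.le _)

theorem layer_fin' {a : ℝ} (ha : 0 < a) (x : ℝ≥0∞) (hx : x ≠ ⊤) :
    ∫⁻ t in Set.Ioi (0:ℝ), (if ENNReal.ofReal t < x then
      ENNReal.ofReal (t ^ (a - 1)) else 0) = (ENNReal.ofReal a)⁻¹ * x ^ a := by
  have := layer_fin ha x.toReal ENNReal.toReal_nonneg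
  rw [ENNReal.ofReal_toReal hx] at this
  rw [this, ENNReal.ofReal_div_of_pos ha, ← ENNReal.ofReal_rpow_of_nonneg ENNReal.toReal_nonneg ha.le,
    ENNReal.ofReal_toReal hx, ENNReal.div_eq_inv_mul]

theorem layer {a : ℝ} (ha : 0 < a) (x : ℝ≥0∞) :
    ∫⁻ t in Set.Ioi (0:ℝ), (if ENNReal.ofReal t < x then
      ENNReal.ofReal (t ^ (a - 1)) else 0) = (ENNReal.ofReal a)⁻¹ * x ^ a := by
  by_cases hx : x = ⊤
  · subst hx
    rw [ENNReal.top_rpow_of_pos ha, ENNReal.mul_top (by simp)]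
    refine ENNReal.eq_top_of_forall_nnreal_le fun r => ?_
    have hr : ((ENNReal.ofReal a * r) ^ (1 / a)) ≠ ⊤ :=
      ENNReal.rpow_ne_top_of_nonneg (by positivity)
        (ENNReal.mul_ne_top ENNReal.ofReal_ne_top ENNReal.coe_ne_top)
    have h := layer_fin' ha _ hr
    rw [← ENNReal.rpow_mul, one_div_mul_cancel ha.ne', ENNReal.rpow_one, ← mul_assoc,
      ENNReal.inv_mul_cancel (by simpa using ha) ENNReal.ofReal_ne_top, one_mul] at h
    rw [← h]
    refine lintegral_mono fun t => ?_
    simp only [ENNReal.ofReal_lt_top, if_true]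
    split_ifs <;> simp
  · exact layer_fin' ha x hx

theorem strong_MR {n : ℕ} {p : ℝ} (hp : 1 < p) (R : ℝ)
    (g : EuclideanSpace ℝ (Fin n) → ℝ≥0∞) (hg : Measurable g) :
    ∫⁻ y, MR R g y ^ p ≤ (ENNReal.ofReal p * (2 * ENNReal.ofReal (5 ^ n)) *
      ((ENNReal.ofReal (p - 1))⁻¹ * 2 ^ (p - 1))) * ∫⁻ y, g y ^ p := by
  have hp0 : 0 < p := by linarith
  have hM := measurable_MR R g
  have e1 : ∀ y, MR R g y ^ p = ENNReal.ofReal p * ∫⁻ t in Set.Ioi (0:ℝ),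
      (if ENNReal.ofReal t < MR R g y then ENNReal.ofReal (t ^ (p - 1)) else 0) := by
    intro y
    rw [layer hp0, ← mul_assoc, ENNReal.mul_inv_cancel (by simpa using hp0) ENNReal.ofReal_ne_top,
      one_mul]
  have m1 : Measurable (Function.uncurry fun (y : EuclideanSpace ℝ (Fin n)) (t : ℝ) =>
      (if ENNReal.ofReal t < MR R g y then ENNReal.ofReal (t ^ (p - 1)) else 0)) := by
    refine Measurable.ite (measurableSet_lt (by fun_prop) (hM.comp measurable_fst))
      (by fun_prop) measurable_const
  have m2 : Measurable (Function.uncurry fun (t : ℝ) (y : EuclideanSpace ℝ (Fin n)) =>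
      g y * (if ENNReal.ofReal t < 2 * g y then ENNReal.ofReal (t ^ (p - 1 - 1)) else 0)) := by
    refine (hg.comp measurable_snd).mul (Measurable.ite (measurableSet_lt (by fun_prop)
      ((hg.comp measurable_snd).const_mul 2)) (by fun_prop) measurable_const)
  have key : ∀ t ∈ Set.Ioi (0:ℝ), ∫⁻ y, (if ENNReal.ofReal t < MR R g y then
      ENNReal.ofReal (t ^ (p - 1)) else 0) ≤ (2 * ENNReal.ofReal (5 ^ n)) *
      ∫⁻ y, g y * (if ENNReal.ofReal t < 2 * g y then ENNReal.ofReal (t ^ (p - 1 - 1)) else 0) := by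
    intro t ht
    have ht : 0 < t := ht
    have w := weak_MR' R g hg (ENNReal.ofReal (t / 2)) ENNReal.ofReal_ne_top
    have e2 : ENNReal.ofReal (t / 2) + ENNReal.ofReal (t / 2) = ENNReal.ofReal t := by
      rw [← ENNReal.ofReal_add (by positivity) (by positivity)]; congr 1; ring
    have e3 : ENNReal.ofReal (t ^ (p - 1)) =
        2 * ENNReal.ofReal (t ^ (p - 1 - 1)) * ENNReal.ofReal (t / 2) := by
      rw [show (2 : ℝ≥0∞) = ENNReal.ofReal 2 by simp, ← ENNReal.ofReal_mul (by norm_num),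
        ← ENNReal.ofReal_mul (by positivity)]
      congr 1
      rw [Real.rpow_sub_one ht.ne' (p - 1)]
      field_simp
    have e4 : ∫⁻ y, (if ENNReal.ofReal t < MR R g y then
      ENNReal.ofReal (t ^ (p - 1)) else 0) = ENNReal.ofReal (t ^ (p - 1)) *
        volume {y | ENNReal.ofReal t < MR R g y} := by
      rw [← lintegral_indicator_const (measurableSet_lt measurable_const hM)]
      refine lintegral_congr fun y => ?_
      simp only [Set.indicator, Set.mem_ofPred_eq]
    have e5 : ∫⁻ y, g y * (if ENNReal.ofReal t < 2 * g y then
        ENNReal.ofReal (t ^ (p - 1 - 1)) else 0) = ENNReal.ofReal (t ^ (p - 1 - 1)) *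
        ∫⁻ y, {y | ENNReal.ofReal (t / 2) < g y}.indicator g y := by
      rw [← lintegral_const_mul' _ _ ENNReal.ofReal_ne_top]
      refine lintegral_congr fun y => ?_
      have : ENNReal.ofReal t < 2 * g y ↔ ENNReal.ofReal (t / 2) < g y := by
        rw [← e2, ← two_mul]
        exact ENNReal.mul_lt_mul_iff_right (by simp) (by simp)
      simp only [Set.indicator, Set.mem_ofPred_eq, this]
      split_ifs <;> simp [mul_comm]
    rw [e2] at w
    rw [e4, e5, e3]
    calc _ = 2 * ENNReal.ofReal (t ^ (p - 1 - 1)) * (ENNReal.ofReal (t / 2) *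
          volume {y | ENNReal.ofReal t < MR R g y}) := by ring
      _ ≤ 2 * ENNReal.ofReal (t ^ (p - 1 - 1)) * (ENNReal.ofReal (5 ^ n) *
          ∫⁻ y, {y | ENNReal.ofReal (t / 2) < g y}.indicator g y) := mul_le_mul_right w _
      _ = _ := by ring
  calc ∫⁻ y, MR R g y ^ p = ENNReal.ofReal p * ∫⁻ t in Set.Ioi (0:ℝ), ∫⁻ y,
      (if ENNReal.ofReal t < MR R g y then ENNReal.ofReal (t ^ (p - 1)) else 0) := by
        simp_rw [e1]
        rw [lintegral_const_mul' _ _ ENNReal.ofReal_ne_top,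
          lintegral_lintegral_swap m1.aemeasurable]
    _ ≤ ENNReal.ofReal p * ∫⁻ t in Set.Ioi (0:ℝ), (2 * ENNReal.ofReal (5 ^ n)) *
      ∫⁻ y, g y * (if ENNReal.ofReal t < 2 * g y then ENNReal.ofReal (t ^ (p - 1 - 1)) else 0) := by
        exact mul_le_mul_right (setLIntegral_mono' measurableSet_Ioi key) _
    _ = ENNReal.ofReal p * ((2 * ENNReal.ofReal (5 ^ n)) * ∫⁻ y, g y *
        ((ENNReal.ofReal (p - 1))⁻¹ * (2 * g y) ^ (p - 1))) := by
        rw [lintegral_const_mul' _ _ (ENNReal.mul_ne_top (by simp) ENNReal.ofReal_ne_top),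
          lintegral_lintegral_swap m2.aemeasurable]
        congr 2
        refine lintegral_congr fun y => ?_
        rw [lintegral_const_mul, layer (by linarith)]
        exact Measurable.ite (measurableSet_lt (by fun_prop) measurable_const)
          (by fun_prop) measurable_const
    _ = ENNReal.ofReal p * ((2 * ENNReal.ofReal (5 ^ n)) *
        ((((ENNReal.ofReal (p - 1))⁻¹ * 2 ^ (p - 1))) * ∫⁻ y, g y ^ p)) := by
        rw [← lintegral_const_mul' _ (fun y => g y ^ p)]
        · congr 2
          refine lintegral_congr fun y => ?_
          rw [ENNReal.mul_rpow_of_nonneg _ _ (by linarith)]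
          have : g y ^ p = g y * g y ^ (p - 1) := by
            conv_rhs => rw [← ENNReal.rpow_one (g y), ← ENNReal.rpow_mul, one_mul]
            rw [← ENNReal.rpow_add_of_nonneg _ _ (by norm_num) (by linarith)]
            congr 1; ring
          rw [this]; ring
        · refine ENNReal.mul_ne_top (by simpa using hp) 
            (ENNReal.rpow_ne_top_of_nonneg (by linarith) (by simp))
    _ = _ := by ring

theorem holder_avg {n : ℕ} {p : ℝ} (hp : 1 < p) (g : EuclideanSpace ℝ (Fin n) → ℝ≥0∞)
    (hg : Measurable g) (z : EuclideanSpace ℝ (Fin n)) {r : ℝ} (hr : 0 < r) :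
    avgB g z r ≤ avgB (fun y => g y ^ p) z r ^ (1 / p) := by
  have hp0 : 0 < p := by linarith
  have h := ENNReal.lintegral_mul_le_Lp_mul_Lq (volume.restrict (ball z r))
    (Real.HolderConjugate.conjExponent hp) hg.aemeasurable (aemeasurable_const (b := (1 : ℝ≥0∞)))
  simp only [Pi.mul_apply, mul_one, ENNReal.one_rpow, lintegral_one, Measure.restrict_apply_univ] at h
  have hv0 := vol_ball_ne_zero z hr
  have hvt := vol_ball_ne_top z r
  have hq : 1 / p.conjExponent = 1 - 1 / p := by
    have := (Real.HolderConjugate.conjExponent hp).inv_add_inv_eq_one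
    simp only [one_div]; linarith
  rw [hq] at h
  unfold avgB
  rw [ENNReal.div_le_iff hv0 hvt, ENNReal.div_rpow_of_nonneg _ _ (by positivity)]
  refine h.trans (le_of_eq ?_)
  rw [ENNReal.rpow_sub _ _ hv0 hvt, ENNReal.rpow_one]
  simp only [div_eq_mul_inv]
  ring

section Final

variable {n : ℕ} {p : ℝ} {φ : EuclideanSpace ℝ (Fin n) → ℝ → ℝ}
  {f : EuclideanSpace ℝ (Fin n) → ℝ}

theorem morrey_int (hp : 1 < p) (hφpos : ∀ x r, 0 < r → 0 < φ x r)
    (x : EuclideanSpace ℝ (Fin n)) {r : ℝ} (hr : 0 < r) :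
    ∫⁻ y in ball x r, ENNReal.ofReal |f y| ^ p ≤
      morreyNorm n p φ f ^ p * (ENNReal.ofReal (φ x r) * volume (ball x r)) := by
  have hp0 : 0 < p := by linarith
  have h : ((∫⁻ y in ball x r, ENNReal.ofReal (|f y| ^ p)) /
      (ENNReal.ofReal (φ x r) * volume (ball x r))) ^ (1 / p) ≤ morreyNorm n p φ f := by
    unfold morreyNorm
    exact le_iSup_of_le x (le_iSup_of_le r (le_iSup_of_le hr le_rfl))
  have h' := ENNReal.rpow_le_rpow h hp0.le
  rw [← ENNReal.rpow_mul, one_div_mul_cancel hp0.ne', ENNReal.rpow_one,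
    ENNReal.div_le_iff (mul_ne_zero (by simpa using hφpos x r hr) (vol_ball_ne_zero x hr))
      (ENNReal.mul_ne_top ENNReal.ofReal_ne_top (vol_ball_ne_top x r))] at h'
  refine le_trans (le_of_eq ?_) h'
  refine lintegral_congr fun y => ?_
  rw [ENNReal.ofReal_rpow_of_nonneg (abs_nonneg _) hp0.le]

theorem morrey_avg (hp : 1 < p) (hφpos : ∀ x r, 0 < r → 0 < φ x r) (hf : Measurable f)
    (x : EuclideanSpace ℝ (Fin n)) {r : ℝ} (hr : 0 < r) :
    avgB (fun y => ENNReal.ofReal |f y|) x r ≤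
      ENNReal.ofReal (φ x r) ^ (1 / p) * morreyNorm n p φ f := by
  have hp0 : 0 < p := by linarith
  refine (holder_avg hp _ (by fun_prop) x hr).trans ?_
  have : avgB (fun y => ENNReal.ofReal |f y| ^ p) x r ≤
      ENNReal.ofReal (φ x r) * morreyNorm n p φ f ^ p := by
    unfold avgB
    rw [ENNReal.div_le_iff (vol_ball_ne_zero x hr) (vol_ball_ne_top x r)]
    refine (morrey_int hp hφpos x hr).trans (le_of_eq ?_)
    ring
  refine (ENNReal.rpow_le_rpow this (by positivity)).trans (le_of_eq ?_)
  rw [ENNReal.mul_rpow_of_nonneg _ _ (by positivity), ← ENNReal.rpow_mul,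
    mul_one_div_cancel hp0.ne', ENNReal.rpow_one]

theorem local_global (hp : 1 < p) (hφpos : ∀ x r, 0 < r → 0 < φ x r) (hf : Measurable f)
    {C : ℝ} (hC : 0 < C) (hdec : ∀ x (r s : ℝ), 0 < r → r < s → φ x s ≤ C * φ x r)
    (x : EuclideanSpace ℝ (Fin n)) {r : ℝ} (hr : 0 < r) {y : EuclideanSpace ℝ (Fin n)}
    (hy : y ∈ ball x r) (z : EuclideanSpace ℝ (Fin n)) {s : ℝ} (hs : 0 < s) (hyz : y ∈ ball z s) :
    avgB (fun y => ENNReal.ofReal |f y|) z s ≤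
      max (MR (r / 2) ((ball x (2 * r)).indicator fun y => ENNReal.ofReal |f y|) y)
        (ENNReal.ofReal (4 ^ n) * (ENNReal.ofReal (C * φ x r) ^ (1 / p) * morreyNorm n p φ f)) := by
  rw [mem_ball] at hy hyz
  have hyz' : dist z y < s := by rwa [dist_comm]
  rcases le_or_gt s (r / 2) with h | h
  · refine le_max_of_le_left ?_
    have hsub : ball z s ⊆ ball x (2 * r) := by
      intro w hw
      rw [mem_ball] at hw ⊢
      have := dist_triangle4 w z y x
      linarith
    have : avgB (fun y => ENNReal.ofReal |f y|) z s =
        avgB ((ball x (2 * r)).indicator fun y => ENNReal.ofReal |f y|) z s := by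
      unfold avgB
      congr 1
      refine setLIntegral_congr_fun measurableSet_ball fun w hw => ?_
      simp only [Set.indicator_of_mem (hsub hw)]
    rw [this]
    unfold MR
    exact le_iSup_of_le z (le_iSup_of_le s (le_iSup_of_le hs (le_iSup_of_le h
      (le_iSup_of_le (mem_ball.2 hyz) le_rfl))))
  · refine le_max_of_le_right ?_
    have hsub : ball z s ⊆ ball x (4 * s) := by
      intro w hw
      rw [mem_ball] at hw ⊢
      have := dist_triangle4 w z y x
      linarith
    have hvol : volume (ball z s) = volume (ball x s) := by
      rw [Measure.addHaar_ball_center volume z s, Measure.addHaar_ball_center volume x s]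
    have h1 : avgB (fun y => ENNReal.ofReal |f y|) z s ≤
        ENNReal.ofReal (4 ^ n) * avgB (fun y => ENNReal.ofReal |f y|) x (4 * s) := by
      unfold avgB
      rw [hvol, vol_ball_mul x (by norm_num) s,
        ENNReal.div_le_iff (vol_ball_ne_zero x hs) (vol_ball_ne_top x s)]
      have h0 : ENNReal.ofReal ((4:ℝ) ^ n) * volume (ball x s) ≠ 0 :=
        mul_ne_zero (by simp) (vol_ball_ne_zero x hs)
      have ht : ENNReal.ofReal ((4:ℝ) ^ n) * volume (ball x s) ≠ ⊤ :=
        ENNReal.mul_ne_top ENNReal.ofReal_ne_top (vol_ball_ne_top x s)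
      calc ∫⁻ y in ball z s, ENNReal.ofReal |f y| ≤ ∫⁻ y in ball x (4 * s), ENNReal.ofReal |f y| :=
            lintegral_mono_set hsub
        _ = (∫⁻ y in ball x (4 * s), ENNReal.ofReal |f y|) /
            (ENNReal.ofReal (4 ^ n) * volume (ball x s)) *
            (ENNReal.ofReal (4 ^ n) * volume (ball x s)) := (ENNReal.div_mul_cancel h0 ht).symm
        _ = _ := by ring
    refine h1.trans (mul_le_mul_right ((morrey_avg hp hφpos hf x (by linarith)).trans ?_) _)
    gcongr
    exact hdec x r (4 * s) hr (by linarith)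

theorem pointwise_gen {q : ℝ} (hp : 1 < p) (hpq : p ≤ q)
    {ρ : EuclideanSpace ℝ (Fin n) → ℝ → ℝ} (hφpos : ∀ x r, 0 < r → 0 < φ x r)
    (hρpos : ∀ x r, 0 < r → 0 < ρ x r) (hf : Measurable f) {C₀ : ℝ}
    (hρφ : ∀ x (r : ℝ), 0 < r → ρ x r * φ x r ^ (1 / p) ≤ C₀ * φ x r ^ (1 / q))
    (z : EuclideanSpace ℝ (Fin n)) {s : ℝ} (hs : 0 < s) :
    ENNReal.ofReal (ρ z s) * avgB (fun y => ENNReal.ofReal |f y|) z s ≤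
      ENNReal.ofReal C₀ * (avgB (fun y => ENNReal.ofReal |f y|) z s ^ (p / q) *
        morreyNorm n p φ f ^ (1 - p / q)) := by
  have hp0 : 0 < p := by linarith
  have hq0 : 0 < q := by linarith
  have hpq1 : 0 ≤ 1 - p / q := by
    rw [sub_nonneg, div_le_one hq0]; exact hpq
  set a := avgB (fun y => ENNReal.ofReal |f y|) z s
  have ha : a ≤ _ := morrey_avg hp hφpos hf z hs
  have hφ := hφpos z s hs
  have e : a = a ^ (p / q) * a ^ (1 - p / q) := by
    rw [← ENNReal.rpow_add_of_nonneg _ _ (by positivity) hpq1]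
    simp
  have h1 : a ^ (1 - p / q) ≤ ENNReal.ofReal (φ z s ^ (1 / p - 1 / q)) *
      morreyNorm n p φ f ^ (1 - p / q) := by
    refine (ENNReal.rpow_le_rpow ha hpq1).trans (le_of_eq ?_)
    rw [ENNReal.mul_rpow_of_nonneg _ _ hpq1, ← ENNReal.rpow_mul, ENNReal.ofReal_rpow_of_pos hφ]
    congr 3
    field_simp
  have h2 : ENNReal.ofReal (ρ z s) * ENNReal.ofReal (φ z s ^ (1 / p - 1 / q)) ≤
      ENNReal.ofReal C₀ := by
    rw [← ENNReal.ofReal_mul (hρpos z s hs).le]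
    refine ENNReal.ofReal_le_ofReal ?_
    rw [Real.rpow_sub hφ, ← mul_div_assoc, div_le_iff₀ (by positivity)]
    exact hρφ z s hs
  calc ENNReal.ofReal (ρ z s) * a = ENNReal.ofReal (ρ z s) * (a ^ (p / q) * a ^ (1 - p / q)) := by
        rw [← e]
    _ ≤ ENNReal.ofReal (ρ z s) * (a ^ (p / q) * (ENNReal.ofReal (φ z s ^ (1 / p - 1 / q)) *
      morreyNorm n p φ f ^ (1 - p / q))) := by gcongr
    _ = (ENNReal.ofReal (ρ z s) * ENNReal.ofReal (φ z s ^ (1 / p - 1 / q))) * (a ^ (p / q) *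
      morreyNorm n p φ f ^ (1 - p / q)) := by ring
    _ ≤ _ := by gcongr

end Final

/-- if `1 < p ≤ q < ∞`, `φ ∈ 𝒢^dec`, `φ(x,r) → ∞` as `r → 0`,
`φ(x,r) → 0` as `r → ∞`, and `ρ(x,r) φ(x,r)^{1/p} ≤ C₀ φ(x,r)^{1/q}`, then `M_ρ`
is bounded from `L^{(p,φ)}` to `L^{(q,φ)}`. -/
theorem genMaximal_bounded (n : ℕ) (p q : ℝ) (hp : 1 < p) (hpq : p ≤ q)
    (ρ φ : EuclideanSpace ℝ (Fin n) → ℝ → ℝ)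
    (hρpos : ∀ x r, 0 < r → 0 < ρ x r)
    (hφpos : ∀ x r, 0 < r → 0 < φ x r)
    (hφdec : Gdec n φ)
    (hφ0 : ∀ x, Tendsto (fun r => φ x r) (nhdsWithin 0 (Set.Ioi 0)) atTop)
    (hphiInf : ∀ x, Tendsto (fun r => φ x r) atTop (nhds 0))
    (C₀ : ℝ) (hC₀ : 0 < C₀)
    (hρφ : ∀ x (r : ℝ), 0 < r → ρ x r * φ x r ^ (1 / p) ≤ C₀ * φ x r ^ (1 / q)) :
    ∃ C : ℝ≥0∞, C ≠ ⊤ ∧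
      ∀ f : EuclideanSpace ℝ (Fin n) → ℝ, Measurable f → morreyNorm n p φ f ≠ ⊤ →
        morreyNormE n q φ (genMaximal n ρ f) ≤ C * morreyNorm n p φ f := by
  have hp0 : 0 < p := by linarith
  have hq0 : 0 < q := by linarith
  have hpq1 : 0 ≤ 1 - p / q := by
    rw [sub_nonneg, div_le_one hq0]; exact hpq
  obtain ⟨C, hC, hG⟩ := hφdec
  have hdec : ∀ x (r s : ℝ), 0 < r → r < s → φ x s ≤ C * φ x r :=
    fun x r s h0 h1 => (hG x r s h0 h1).1
  obtain ⟨K, hKt, hK⟩ : ∃ K : ℝ≥0∞, K ≠ ⊤ ∧ ∀ (R : ℝ) (g : EuclideanSpace ℝ (Fin n) → ℝ≥0∞),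
      Measurable g → ∫⁻ y, MR R g y ^ p ≤ K * ∫⁻ y, g y ^ p := by
    refine ⟨_, ?_, fun R g hg => strong_MR hp R g hg⟩
    refine ENNReal.mul_ne_top (ENNReal.mul_ne_top ENNReal.ofReal_ne_top
      (ENNReal.mul_ne_top (by simp) ENNReal.ofReal_ne_top)) (ENNReal.mul_ne_top (by simpa using hp)
            (ENNReal.rpow_ne_top_of_nonneg (by linarith) (by simp)))
  let L : ℝ≥0∞ := K * (ENNReal.ofReal C * ENNReal.ofReal (2 ^ n)) +
    ENNReal.ofReal (4 ^ n) ^ p * ENNReal.ofReal C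
  have hL : L ≠ ⊤ := ENNReal.add_ne_top.2
    ⟨ENNReal.mul_ne_top hKt (ENNReal.mul_ne_top ENNReal.ofReal_ne_top ENNReal.ofReal_ne_top),
      ENNReal.mul_ne_top (ENNReal.rpow_ne_top_of_nonneg hp0.le ENNReal.ofReal_ne_top)
        ENNReal.ofReal_ne_top⟩
  refine ⟨ENNReal.ofReal C₀ * L ^ (1 / q), ENNReal.mul_ne_top ENNReal.ofReal_ne_top
    (ENNReal.rpow_ne_top_of_nonneg (by positivity) hL), fun f hf hN => ?_⟩
  set N := morreyNorm n p φ f with hNdef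
  unfold morreyNormE
  refine iSup_le fun x => iSup_le fun r => iSup_le fun hr => ?_
  set V := volume (ball x r) with hV
  set Φ := ENNReal.ofReal (φ x r) with hΦ
  have hV0 : V ≠ 0 := vol_ball_ne_zero x hr
  have hVt : V ≠ ⊤ := vol_ball_ne_top x r
  have hΦ0 : Φ ≠ 0 := by simpa [hΦ] using hφpos x r hr
  have hΦt : Φ ≠ ⊤ := ENNReal.ofReal_ne_top
  let G := (ball x (2 * r)).indicator fun y => ENNReal.ofReal |f y|
  have hGm : Measurable G := Measurable.indicator (by fun_prop) measurableSet_ball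
  let c : ℝ≥0∞ := ENNReal.ofReal (4 ^ n) * (ENNReal.ofReal (C * φ x r) ^ (1 / p) * N)
  let D : EuclideanSpace ℝ (Fin n) → ℝ≥0∞ := fun y => max (MR (r / 2) G y) c
  have hcp : c ^ p = ENNReal.ofReal (4 ^ n) ^ p * ENNReal.ofReal C * (Φ * N ^ p) := by
    simp only [c]
    rw [ENNReal.mul_rpow_of_nonneg _ _ hp0.le, ENNReal.mul_rpow_of_nonneg _ _ hp0.le,
      ← ENNReal.rpow_mul, one_div_mul_cancel hp0.ne', ENNReal.rpow_one, ENNReal.ofReal_mul hC.le]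
    ring
  have hDint : ∫⁻ y in ball x r, D y ^ p ≤ L * (N ^ p * (Φ * V)) := by
    have hG : ∫⁻ y, G y ^ p ≤ (ENNReal.ofReal C * ENNReal.ofReal (2 ^ n)) * (N ^ p * (Φ * V)) := by
      have e : ∫⁻ y, G y ^ p = ∫⁻ y in ball x (2 * r), ENNReal.ofReal |f y| ^ p := by
        rw [← lintegral_indicator measurableSet_ball]
        refine lintegral_congr fun y => ?_
        simp only [G, Set.indicator]
        split_ifs
        · rfl
        · exact ENNReal.zero_rpow_of_pos hp0
      rw [e]
      refine (morrey_int hp hφpos x (by linarith)).trans ?_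
      rw [vol_ball_mul x (by norm_num)]
      have : ENNReal.ofReal (φ x (2 * r)) ≤ ENNReal.ofReal C * Φ := by
        rw [hΦ, ← ENNReal.ofReal_mul hC.le]
        exact ENNReal.ofReal_le_ofReal (hdec x r _ hr (by linarith))
      calc _ ≤ N ^ p * (ENNReal.ofReal C * Φ * (ENNReal.ofReal (2 ^ n) * V)) := by gcongr
        _ = _ := by ring
    calc ∫⁻ y in ball x r, D y ^ p ≤ ∫⁻ y in ball x r, (MR (r / 2) G y ^ p + c ^ p) := by
          refine lintegral_mono fun y => ?_
          rcases max_choice (MR (r / 2) G y) c with h | h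
          · simp only [D, h]; exact le_self_add
          · simp only [D, h]; exact le_add_self
      _ = (∫⁻ y in ball x r, MR (r / 2) G y ^ p) + c ^ p * V := by
          rw [lintegral_add_right _ measurable_const, setLIntegral_const]
      _ ≤ K * ((ENNReal.ofReal C * ENNReal.ofReal (2 ^ n)) * (N ^ p * (Φ * V))) + c ^ p * V := by
          gcongr
          exact (setLIntegral_le_lintegral _ _).trans ((hK _ _ hGm).trans (mul_le_mul_right hG _))
      _ = _ := by rw [hcp]; simp only [L]; ring
  have hpt : ∀ y ∈ ball x r, genMaximal n ρ f y ^ q ≤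
      (ENNReal.ofReal C₀ ^ q * N ^ (q - p)) * D y ^ p := by
    intro y hy
    have h1 : genMaximal n ρ f y ≤ ENNReal.ofReal C₀ * (D y ^ (p / q) * N ^ (1 - p / q)) := by
      unfold genMaximal
      refine iSup_le fun z => iSup_le fun s => iSup_le fun hs => iSup_le fun hyz => ?_
      refine (pointwise_gen hp hpq hφpos hρpos hf hρφ z hs).trans ?_
      have := local_global hp hφpos hf hC hdec x hr hy z hs hyz
      refine mul_le_mul_right (mul_le_mul_left (ENNReal.rpow_le_rpow this (by positivity)) _) _
    refine (ENNReal.rpow_le_rpow h1 hq0.le).trans (le_of_eq ?_)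
    rw [ENNReal.mul_rpow_of_nonneg _ _ hq0.le, ENNReal.mul_rpow_of_nonneg _ _ hq0.le,
      ← ENNReal.rpow_mul, ← ENNReal.rpow_mul, div_mul_cancel₀ _ hq0.ne', sub_mul,
      div_mul_cancel₀ _ hq0.ne', one_mul]
    ring
  have hfin : (∫⁻ y in ball x r, genMaximal n ρ f y ^ q) / (Φ * V) ≤
      ENNReal.ofReal C₀ ^ q * L * N ^ q := by
    rw [ENNReal.div_le_iff (mul_ne_zero hΦ0 hV0) (ENNReal.mul_ne_top hΦt hVt)]
    calc _ ≤ ∫⁻ y in ball x r, (ENNReal.ofReal C₀ ^ q * N ^ (q - p)) * D y ^ p :=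
          setLIntegral_mono' measurableSet_ball hpt
      _ = (ENNReal.ofReal C₀ ^ q * N ^ (q - p)) * ∫⁻ y in ball x r, D y ^ p :=
          lintegral_const_mul' _ _ (ENNReal.mul_ne_top
            (ENNReal.rpow_ne_top_of_nonneg hq0.le ENNReal.ofReal_ne_top)
            (ENNReal.rpow_ne_top_of_nonneg (by linarith) hN))
      _ ≤ (ENNReal.ofReal C₀ ^ q * N ^ (q - p)) * (L * (N ^ p * (Φ * V))) := by gcongr
      _ = ENNReal.ofReal C₀ ^ q * L * (N ^ (q - p) * N ^ p) * (Φ * V) := by ring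
      _ = _ := by
          rw [← ENNReal.rpow_add_of_nonneg _ _ (by linarith) hp0.le, sub_add_cancel]
  refine (ENNReal.rpow_le_rpow hfin (by positivity)).trans (le_of_eq ?_)
  rw [ENNReal.mul_rpow_of_nonneg _ _ (by positivity), ENNReal.mul_rpow_of_nonneg _ _ (by positivity),
    ← ENNReal.rpow_mul, ← ENNReal.rpow_mul, mul_one_div_cancel hq0.ne', ENNReal.rpow_one,
    ENNReal.rpow_one]
end
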